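/- Let 𝒮 be a family of 3-sets of positive integers such that the union-closed family ⟨𝒮⟩ generated by 𝒮 is Non–Frankl-Complete, {1,2,3} ∈ 𝒮, and |𝒮_1| = |𝒮_2| = |𝒮_3| = 2. Then 𝒮 contains a subfamily isomorphic to ℐ = {{1,2,3},{1,2,4},{3,5,6}} (i.e., the image of ℐ under some injective map of ground elements). -/

import Mathlib

/-- A family of sets is union-closed. -/
def UC (F : Finset (Finset ℕ)) : Prop := ∀ A ∈ F, ∀ B ∈ F, A ∪ B ∈ F

/-- `famU F` is the union `U(F)` of all members of the family `F`. -/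
def famU (F : Finset (Finset ℕ)) : Finset ℕ := F.sup id

/-- `memFam F i` is the subfamily `F_i` of sets in `F` containing `i`. -/
def memFam (F : Finset (Finset ℕ)) (i : ℕ) : Finset (Finset ℕ) :=
  F.filter (fun S => i ∈ S)

/-- `A` is Non–Frankl-Complete: some union-closed family containing `A` has every
element of `U(A)` in fewer than half of its sets. -/
def NonFC (A : Finset (Finset ℕ)) : Prop :=
  ∃ F : Finset (Finset ℕ), UC F ∧ A ⊆ F ∧
    ∀ i ∈ famU A, 2 * (memFam F i).card < F.card

/-- `gen S` is the union-closed family generated by `S`: the smallest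
union-closed family containing `S`, given explicitly as all unions of
nonempty subfamilies of `S`. -/
def gen (S : Finset (Finset ℕ)) : Finset (Finset ℕ) :=
  (S.powerset.filter (fun T => T.Nonempty)).image (fun T => T.sup id)

/-- The image of a family under a relabeling of ground elements. -/
def mapFam (f : ℕ → ℕ) (A : Finset (Finset ℕ)) : Finset (Finset ℕ) :=
  A.image (fun S => S.image f)


/-! ### Families on three points, encoded as numbers -/

/-- The number whose binary digit at `n < 8` records whether `p n` holds. Reading `n < 8` as a
subset of a three-element set, such a number encodes a family of subsets of that set. -/
def bitMask (p : ℕ → Bool) : ℕ :=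
  (List.range 8).foldr (fun n m => 2 * m + (p n).toNat) 0

theorem bitMask_lt (p : ℕ → Bool) : bitMask p < 256 := by
  simp only [bitMask, List.range, List.range.loop, List.foldr]
  have h := fun n => (p n).toNat_lt
  grind

theorem testBit_bitMask (p : ℕ → Bool) {n : ℕ} (hn : n < 8) :
    (bitMask p).testBit n = p n := by
  simp only [bitMask, List.range, List.range.loop, List.foldr]
  interval_cases n <;>
  · generalize p 0 = b₀, p 1 = b₁, p 2 = b₂, p 3 = b₃, p 4 = b₄, p 5 = b₅, p 6 = b₆, p 7 = b₇
    revert b₀ b₁ b₂ b₃ b₄ b₅ b₆ b₇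
    decide

theorem bitMask_and_eq {p q : ℕ → Bool} (h : ∀ n < 8, p n = true → q n = true) :
    bitMask p &&& bitMask q = bitMask p := by
  apply Nat.eq_of_testBit_eq
  intro n
  rw [Nat.testBit_and]
  by_cases hn : n < 8
  · rw [testBit_bitMask p hn, testBit_bitMask q hn]
    have := h n hn
    cases hp : p n <;> simp_all
  · have : (bitMask p).testBit n = false :=
      Nat.testBit_lt_two_pow ((bitMask_lt p).trans_le
        (Nat.pow_le_pow_right (n := 2) (i := 8) (by norm_num) (by omega)))
    simp [this]

/-- The sets whose union with `k` lies in `H`. -/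
def shiftMask (k H : ℕ) : ℕ := bitMask fun n => H.testBit (n ||| k)

/-- The sets whose union with every member of `H` lies in `H`. -/
def absorbMask (H : ℕ) : ℕ :=
  bitMask fun n => (List.range 8).all fun m => !H.testBit m || H.testBit (n ||| m)

/-- `maskRel K G H`: uniting a member of `G` with a member of `H`, or with an element of `K`,
gives a member of `H`. -/
def maskRel (K : List ℕ) (G H : ℕ) : Bool :=
  Nat.beq (G &&& absorbMask H) G && K.all fun k => Nat.beq (G &&& shiftMask k H) G

/-- The union-closed families on three points that are empty or contain the full set. -/
def closedMasks : List ℕ := (List.range 256).filter fun G => maskRel [7] G G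

/-- The total weight of the members of a family. -/
def weightSum (w : ℕ → ℤ) (G : ℕ) : ℤ :=
  ((List.range 8).map fun n => if G.testBit n then w n else 0).sum

theorem weightSum_eq_sum (w : ℕ → ℤ) (G : ℕ) :
    weightSum w G = ∑ n ∈ Finset.range 8, if G.testBit n then w n else 0 := by
  rw [weightSum, ← List.sum_toFinset _ List.nodup_range, List.toFinset_range]

theorem weightSum_bitMask (w : ℕ → ℤ) (p : ℕ → Bool) :
    weightSum w (bitMask p) = ∑ n ∈ Finset.range 8, if p n then w n else 0 := by
  rw [weightSum_eq_sum]
  refine Finset.sum_congr rfl fun n hn => ?_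
  rw [testBit_bitMask p (Finset.mem_range.mp hn)]

theorem weightSum_congr {w w' : ℕ → ℤ} (h : ∀ n < 8, w n = w' n) (G : ℕ) :
    weightSum w G = weightSum w' G := by
  simp only [weightSum_eq_sum]
  exact Finset.sum_congr rfl fun n hn => by rw [h n (Finset.mem_range.mp hn)]

/-- The minimum of `f` on a list, capped at a large constant. -/
def minScore (f : ℕ → ℤ) (l : List ℕ) : ℤ := l.foldr (fun x m => min (f x) m) 1000

theorem minScore_le (f : ℕ → ℤ) {l : List ℕ} {x : ℕ} (hx : x ∈ l) : minScore f l ≤ f x := by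
  induction l with
  | nil => simp at hx
  | cons y l ih =>
    rcases List.mem_cons.mp hx with rfl | hx
    · exact min_le_left _ _
    · exact (min_le_right _ _).trans (ih hx)

/-- Checks that `f₀ G₀ + f₁ G₁ + f₂ G₂ + f₃ H` is nonnegative for all squares of closed families
`G₀, G₁, G₂, H` related as in `le_of_squareCheck`. -/
def squareCheck (K₀₁ K₀₃ K₁₃ K₂₃ K₃₃ : List ℕ) (f₀ f₁ f₂ f₃ : ℕ → ℤ) : Bool :=
  (closedMasks.filter fun H => maskRel K₃₃ H H).all fun H =>
    (closedMasks.filter fun G => maskRel K₀₃ G H).all fun G₀ =>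
      decide (0 ≤ f₀ G₀ + f₃ H +
        (minScore f₁ ((closedMasks.filter fun G => maskRel K₁₃ G H).filter
          fun G => maskRel K₀₁ G₀ G) +
        minScore f₂ ((closedMasks.filter fun G => maskRel K₂₃ G H).filter
          fun G => maskRel [] G₀ G)))

theorem le_of_squareCheck {K₀₁ K₀₃ K₁₃ K₂₃ K₃₃ : List ℕ} {f₀ f₁ f₂ f₃ : ℕ → ℤ}
    (h : squareCheck K₀₁ K₀₃ K₁₃ K₂₃ K₃₃ f₀ f₁ f₂ f₃ = true) {G₀ G₁ G₂ H : ℕ}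
    (h₀ : G₀ ∈ closedMasks) (h₁ : G₁ ∈ closedMasks) (h₂ : G₂ ∈ closedMasks)
    (h₃ : H ∈ closedMasks) (h₀₁ : maskRel K₀₁ G₀ G₁ = true) (h₀₂ : maskRel [] G₀ G₂ = true)
    (h₀₃ : maskRel K₀₃ G₀ H = true) (h₁₃ : maskRel K₁₃ G₁ H = true)
    (h₂₃ : maskRel K₂₃ G₂ H = true) (h₃₃ : maskRel K₃₃ H H = true) :
    0 ≤ f₀ G₀ + f₁ G₁ + f₂ G₂ + f₃ H := by
  have h' := List.all_eq_true.mp h H (List.mem_filter.mpr ⟨h₃, h₃₃⟩)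
  have h'' := of_decide_eq_true (List.all_eq_true.mp h' G₀ (List.mem_filter.mpr ⟨h₀, h₀₃⟩))
  have l₁ := minScore_le f₁ (l := (closedMasks.filter fun G => maskRel K₁₃ G H).filter
    fun G => maskRel K₀₁ G₀ G) (x := G₁) (by simp [List.mem_filter, h₁, h₁₃, h₀₁])
  have l₂ := minScore_le f₂ (l := (closedMasks.filter fun G => maskRel K₂₃ G H).filter
    fun G => maskRel [] G₀ G) (x := G₂) (by simp [List.mem_filter, h₂, h₂₃, h₀₂])
  linarith

/-- The number of elements of the subset of a three-element set encoded by `n`. -/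
def cornerSize (n : ℕ) : ℤ :=
  (n.testBit 0).toNat + (n.testBit 1).toNat + (n.testBit 2).toNat

/-- The number of members of a family. -/
def maskCard (G : ℕ) : ℤ := weightSum (fun _ => 1) G

theorem weightSum_add_const (w : ℕ → ℤ) (c : ℤ) (G : ℕ) :
    weightSum (fun n => w n + c) G = weightSum w G + c * maskCard G := by
  simp only [maskCard, weightSum_eq_sum, Finset.mul_sum, ← Finset.sum_add_distrib]
  exact Finset.sum_congr rfl fun n _ => by split_ifs <;> ring

/-- The total of `4 |X| + c` over the members `X` of a family. -/
def shiftedScore (c : ℤ) (G : ℕ) : ℤ := weightSum (fun n => 4 * cornerSize n + c) G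

/-- The share of a family (in thirds) that is charged to the first of the three points. The
hexadecimal digits of the constant list the values, increased by `3`; they solve the linear
program given by `charge_square_nonneg` and `charge_add_charge_add_charge_le`. -/
def charge (G : ℕ) : ℤ :=
  ((38016709085144181797775850048492330071783784953790250360110289493173889940562505754871332228153122236680569252400380639917181064622070851888575805624614763872119827853331505908101724110099620285668671830880757137044088792298293204489032081018825263247211696194684542370208092834489983615529856212658615746563
    >>> (4 * G) % 16 : ℕ) : ℤ) - 3

/-- The family obtained by relabeling the three points, subsets being relabeled by the list. -/
def relabelMask (l : List ℕ) (G : ℕ) : ℕ := bitMask fun n => G.testBit (l.getD n 0)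

theorem charge_square_nonneg :
    squareCheck [] [1] [1] [1] [] (fun G => charge G - 3 * maskCard G) charge charge
      (fun G => charge G + 3 * maskCard G) = true := by
  decide +kernel

theorem shiftedScore_square_nonneg :
    squareCheck [3] [4] [4] [3, 4] [3, 4] (shiftedScore (-9)) (shiftedScore (-5))
      (shiftedScore (-7)) (shiftedScore (-3)) = true := by
  decide +kernel

theorem charge_add_charge_add_charge_le :
    ∀ G ∈ closedMasks,
      charge G + charge (relabelMask [0, 2, 1, 3, 4, 6, 5, 7] G) +
        charge (relabelMask [0, 4, 2, 6, 1, 5, 3, 7] G) ≤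
          3 * weightSum (fun n => 2 * cornerSize n - 3) G := by
  decide +kernel

theorem maskCard_relabelMask :
    ∀ G ∈ closedMasks, maskCard (relabelMask [0, 2, 1, 3, 4, 6, 5, 7] G) = maskCard G ∧
      maskCard (relabelMask [0, 4, 2, 6, 1, 5, 3, 7] G) = maskCard G := by
  decide +kernel

/-! ### Traces of a family on three points -/

/-- The subset of `{x, y, z}` encoded by `n`. -/
def corner (x y z n : ℕ) : Finset ℕ :=
  (if n.testBit 0 then {x} else ∅) ∪ (if n.testBit 1 then {y} else ∅) ∪
    (if n.testBit 2 then {z} else ∅)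

theorem corner_or (x y z m n : ℕ) : corner x y z (m ||| n) = corner x y z m ∪ corner x y z n := by
  ext a
  simp only [corner, Nat.testBit_or, Finset.mem_union]
  cases m.testBit 0 <;> cases m.testBit 1 <;> cases m.testBit 2 <;> cases n.testBit 0 <;>
    cases n.testBit 1 <;> cases n.testBit 2 <;> simp <;> tauto

/-- The family of all `X ⊆ {x, y, z}` with `Y ∪ X ∈ F`. -/
def traceMask (F : Finset (Finset ℕ)) (x y z : ℕ) (Y : Finset ℕ) : ℕ :=
  bitMask fun n => decide (Y ∪ corner x y z n ∈ F)

theorem maskRel_traceMask {F : Finset (Finset ℕ)} (hF : UC F) {x y z : ℕ} {K : List ℕ}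
    {Y Y' : Finset ℕ} (hY : Y ⊆ Y')
    (hK : ∀ k ∈ K, ∃ Q, corner x y z k ∪ Q ∈ F ∧ Y ∪ Q = Y') (hK8 : ∀ k ∈ K, k < 8) :
    maskRel K (traceMask F x y z Y) (traceMask F x y z Y') = true := by
  have bit {n : ℕ} (hn : n < 8) :
      (traceMask F x y z Y').testBit n = true ↔ Y' ∪ corner x y z n ∈ F := by
    rw [traceMask, testBit_bitMask _ hn, decide_eq_true_iff]
  have or_lt {m n : ℕ} (hm : m < 8) (hn : n < 8) : m ||| n < 8 := Nat.or_lt_two_pow (n := 3) hm hn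
  simp only [maskRel, Bool.and_eq_true, List.all_eq_true, Nat.beq_eq]
  refine ⟨bitMask_and_eq fun n hn h => ?_, fun k hk => bitMask_and_eq fun n hn h => ?_⟩
  · rw [decide_eq_true_iff] at h
    simp only [List.all_eq_true, List.mem_range]
    intro m hm
    by_cases hmY : (traceMask F x y z Y').testBit m = true
    · rw [bit hm] at hmY
      have := hF _ h _ hmY
      rw [Finset.union_union_union_comm, Finset.union_eq_right.mpr hY, ← corner_or,
        ← bit (or_lt hn hm)] at this
      simp [this]
    · simp [hmY]
  · rw [decide_eq_true_iff] at h
    obtain ⟨Q, hQ, rfl⟩ := hK k hk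
    rw [bit (or_lt hn (hK8 k hk)), corner_or]
    have := hF _ h _ hQ
    rwa [Finset.union_comm (corner x y z k), Finset.union_union_union_comm] at this

theorem mem_union_corner {x y z i n : ℕ} {Y : Finset ℕ} (hix : i ≠ x) (hiy : i ≠ y)
    (hiz : i ≠ z) : i ∈ Y ∪ corner x y z n ↔ i ∈ Y := by
  simp only [corner, Finset.mem_union]
  cases n.testBit 0 <;> cases n.testBit 1 <;> cases n.testBit 2 <;> simp [hix, hiy, hiz]

theorem sum_ite_mem_corner {x y z : ℕ} {Y : Finset ℕ} (hxy : x ≠ y) (hxz : x ≠ z) (hyz : y ≠ z)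
    (hx : x ∉ Y) (hy : y ∉ Y) (hz : z ∉ Y) (n : ℕ) :
    (if x ∈ Y ∪ corner x y z n then (1 : ℤ) else 0) +
      (if y ∈ Y ∪ corner x y z n then 1 else 0) + (if z ∈ Y ∪ corner x y z n then 1 else 0) =
        cornerSize n := by
  simp only [corner, cornerSize, Finset.mem_union]
  cases n.testBit 0 <;> cases n.testBit 1 <;> cases n.testBit 2 <;>
    simp [hxy, hxz, hyz, hxy.symm, hxz.symm, hyz.symm, hx, hy, hz]

theorem corner_seven (x y z : ℕ) : corner x y z 7 = {x, y, z} := by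
  ext a; simp [corner, Nat.testBit]

theorem traceMask_mem_closedMasks {F : Finset (Finset ℕ)} (hF : UC F) {x y z : ℕ}
    (hxyz : {x, y, z} ∈ F) (Y : Finset ℕ) : traceMask F x y z Y ∈ closedMasks := by
  refine List.mem_filter.mpr ⟨List.mem_range.mpr (bitMask_lt _), ?_⟩
  refine maskRel_traceMask hF subset_rfl ?_ (by simp)
  simpa using ⟨∅, by simpa [corner_seven] using hxyz, by simp⟩

theorem weightSum_traceMask (F : Finset (Finset ℕ)) (x y z : ℕ) (Y : Finset ℕ) (w : ℕ → ℤ) :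
    weightSum w (traceMask F x y z Y) =
      ∑ n ∈ Finset.range 8, if Y ∪ corner x y z n ∈ F then w n else 0 := by
  simp [traceMask, weightSum_bitMask]

theorem relabelMask_traceMask (F : Finset (Finset ℕ)) {x y z x' y' z' : ℕ} (Y : Finset ℕ)
    {l : List ℕ} (hl : ∀ n < 8, l.getD n 0 < 8)
    (h : ∀ n < 8, corner x' y' z' n = corner x y z (l.getD n 0)) :
    traceMask F x' y' z' Y = relabelMask l (traceMask F x y z Y) := by
  have congr {p q : ℕ → Bool} (hpq : ∀ n < 8, p n = q n) : bitMask p = bitMask q := by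
    simp [bitMask, List.range, List.range.loop, hpq]
  refine congr fun n hn => ?_
  rw [traceMask, testBit_bitMask _ (hl n hn), h n hn]

theorem traceMask_swap_first_second (F : Finset (Finset ℕ)) (x y z : ℕ) (Y : Finset ℕ) :
    traceMask F y x z Y = relabelMask [0, 2, 1, 3, 4, 6, 5, 7] (traceMask F x y z Y) := by
  refine relabelMask_traceMask F Y (by decide) fun n hn => ?_
  ext a
  interval_cases n <;> simp [corner, Nat.testBit] <;> tauto

theorem traceMask_swap_first_third (F : Finset (Finset ℕ)) (x y z : ℕ) (Y : Finset ℕ) :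
    traceMask F z y x Y = relabelMask [0, 4, 2, 6, 1, 5, 3, 7] (traceMask F x y z Y) := by
  refine relabelMask_traceMask F Y (by decide) fun n hn => ?_
  ext a
  interval_cases n <;> simp [corner, Nat.testBit] <;> tauto

/-- Summation over a family, grouped by the part of each set outside `{x, y, z}`. -/
theorem sum_eq_sum_weightSum {F : Finset (Finset ℕ)} {x y z : ℕ} {D : Finset ℕ} (hxy : x ≠ y)
    (hxz : x ≠ z) (hyz : y ≠ z) (hx : x ∉ D) (hy : y ∉ D) (hz : z ∉ D)
    (hD : famU F ⊆ insert x (insert y (insert z D))) (h : Finset ℕ → ℤ) :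
    ∑ A ∈ F, h A = ∑ Y ∈ D.powerset,
      weightSum (fun n => h (Y ∪ corner x y z n)) (traceMask F x y z Y) := by
  have hF : F = (insert x (insert y (insert z D))).powerset.filter (· ∈ F) := by
    ext A
    simp only [Finset.mem_filter, Finset.mem_powerset]
    exact ⟨fun hA => ⟨(Finset.le_sup (f := id) hA).trans hD, hA⟩, And.right⟩
  have hy' : y ∉ insert z D := by simp [hyz, hy]
  have hx' : x ∉ insert y (insert z D) := by simp [hxy, hxz, hx]
  rw [hF, Finset.sum_filter, ← hF]
  simp only [Finset.sum_powerset_insert hx', Finset.sum_powerset_insert hy',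
    Finset.sum_powerset_insert hz, ← Finset.sum_add_distrib]
  refine Finset.sum_congr rfl fun Y _ => ?_
  simp only [weightSum_traceMask, Finset.sum_range_succ, Finset.sum_range_zero]
  have e (n : ℕ) (B : Finset ℕ) (hB : Y ∪ corner x y z n = B) :
      (if Y ∪ corner x y z n ∈ F then h (Y ∪ corner x y z n) else 0) =
        if B ∈ F then h B else 0 := by rw [hB]
  rw [e 0 Y, e 1 (insert x Y), e 2 (insert y Y), e 3 (insert x (insert y Y)), e 4 (insert z Y),
    e 5 (insert x (insert z Y)), e 6 (insert y (insert z Y)),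
    e 7 (insert x (insert y (insert z Y)))]
  · ring
  all_goals
    ext a
    simp [corner, Nat.testBit]

theorem sum_powerset_eq_sum_square {D : Finset ℕ} {d e : ℕ} (hde : d ≠ e) (hd : d ∈ D)
    (he : e ∈ D) (φ : Finset ℕ → ℤ) :
    ∑ Y ∈ D.powerset, φ Y = ∑ Y ∈ ((D.erase d).erase e).powerset,
      (φ Y + φ (insert d Y) + φ (insert e Y) + φ (insert d (insert e Y))) := by
  have he' : e ∈ D.erase d := Finset.mem_erase.mpr ⟨hde.symm, he⟩
  conv_lhs => rw [← Finset.insert_erase hd, ← Finset.insert_erase he']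
  rw [Finset.sum_powerset_insert (by simp [hde]), Finset.sum_powerset_insert (by simp),
    Finset.sum_powerset_insert (by simp)]
  simp only [← Finset.sum_add_distrib]
  exact Finset.sum_congr rfl fun Y _ => by ring

/-! ### Two Frankl-complete configurations -/

theorem subset_insert_sdiff (F : Finset (Finset ℕ)) (W : Finset ℕ) {x y z : ℕ} :
    famU F ⊆ insert x (insert y (insert z ((famU F ∪ W) \ {x, y, z}))) := by
  intro a ha
  simp only [Finset.mem_insert, Finset.mem_sdiff, Finset.mem_union, Finset.mem_singleton]
  tauto

theorem sum_ite_mem_lt {F : Finset (Finset ℕ)} {i : ℕ} (h : 2 * (memFam F i).card < F.card) :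
    2 * ∑ A ∈ F, (if i ∈ A then (1 : ℤ) else 0) < ∑ _A ∈ F, (1 : ℤ) := by
  rw [Finset.sum_boole]
  simpa [memFam] using (by exact_mod_cast h : (2 : ℤ) * (memFam F i).card < F.card)

theorem sum_charge_nonneg {F : Finset (Finset ℕ)} (hF : UC F) {x y z d e : ℕ} {D : Finset ℕ}
    (hde : d ≠ e) (hd : d ∈ D) (he : e ∈ D) (hxyz : {x, y, z} ∈ F) (hx : {x, d, e} ∈ F) :
    0 ≤ ∑ Y ∈ D.powerset, (charge (traceMask F x y z Y) +
      3 * ((if d ∈ Y then 1 else 0) + (if e ∈ Y then 1 else 0) - 1) *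
        maskCard (traceMask F x y z Y)) := by
  rw [sum_powerset_eq_sum_square hde hd he]
  refine Finset.sum_nonneg fun Y hY => ?_
  have hdY : d ∉ Y := fun h => by simpa using Finset.mem_powerset.mp hY h
  have heY : e ∉ Y := fun h => by simpa using Finset.mem_powerset.mp hY h
  have mem := traceMask_mem_closedMasks hF hxyz
  have corner_one : corner x y z 1 ∪ {d, e} ∈ F := by
    convert hx using 1
    ext a; simp [corner, Nat.testBit]; tauto
  have key := le_of_squareCheck charge_square_nonneg (mem Y) (mem (insert d Y)) (mem (insert e Y))
    (mem (insert d (insert e Y)))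
    (maskRel_traceMask hF (by grind) (by simp) (by simp))
    (maskRel_traceMask hF (by grind) (by simp) (by simp))
    (maskRel_traceMask hF (by grind) (by simpa using ⟨_, corner_one, by grind⟩) (by simp))
    (maskRel_traceMask hF (by grind) (by simpa using ⟨_, corner_one, by grind⟩) (by simp))
    (maskRel_traceMask hF (by grind) (by simpa using ⟨_, corner_one, by grind⟩) (by simp))
    (maskRel_traceMask hF subset_rfl (by simp) (by simp))
  simp [hde, hde.symm, hdY, heY] at key ⊢
  linarith

/-- A triple, with a further triple through each of its points, is Frankl-complete. -/
theorem exists_le_of_triple_of_pendants {F : Finset (Finset ℕ)} (hF : UC F)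
    {x y z d₁ e₁ d₂ e₂ d₃ e₃ : ℕ} {W : Finset ℕ} (hxy : x ≠ y) (hxz : x ≠ z) (hyz : y ≠ z)
    (h₁ : d₁ ≠ e₁) (h₂ : d₂ ≠ e₂) (h₃ : d₃ ≠ e₃) (hW : W = {d₁, e₁, d₂, e₂, d₃, e₃})
    (hx : x ∉ W) (hy : y ∉ W) (hz : z ∉ W)
    (hxyz : {x, y, z} ∈ F) (hx' : {x, d₁, e₁} ∈ F) (hy' : {y, d₂, e₂} ∈ F)
    (hz' : {z, d₃, e₃} ∈ F) :
    ∃ i ∈ insert x (insert y (insert z W)), F.card ≤ 2 * (memFam F i).card := by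
  by_contra! hlt
  have lt {i : ℕ} (hi : i ∈ insert x (insert y (insert z W))) := sum_ite_mem_lt (hlt i hi)
  set D := (famU F ∪ W) \ {x, y, z} with hDdef
  have hWD : W ⊆ D := by
    intro w hw
    simp only [hDdef, Finset.mem_sdiff, Finset.mem_union, Finset.mem_insert, Finset.mem_singleton]
    refine ⟨Or.inr hw, ?_⟩
    rintro (rfl | rfl | rfl) <;> contradiction
  have hyxz : {y, x, z} ∈ F := by rwa [Finset.insert_comm]
  have hzyx : {z, y, x} ∈ F := by convert hxyz using 1; ext a; simp; tauto
  have s₁ := sum_charge_nonneg hF h₁ (hWD (by simp [hW])) (hWD (by simp [hW])) hxyz hx'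
  have s₂ := sum_charge_nonneg hF h₂ (hWD (by simp [hW])) (hWD (by simp [hW])) hyxz hy'
  have s₃ := sum_charge_nonneg hF h₃ (hWD (by simp [hW])) (hWD (by simp [hW])) hzyx hz'
  have hxD : x ∉ D := by simp [hDdef]
  have hyD : y ∉ D := by simp [hDdef]
  have hzD : z ∉ D := by simp [hDdef]
  let ind (i : ℕ) (A : Finset ℕ) : ℤ := if i ∈ A then 1 else 0
  have total := sum_eq_sum_weightSum hxy hxz hyz (F := F) hxD hyD hzD (subset_insert_sdiff F W)
    fun A => 2 * (ind x A + ind y A + ind z A) - 3 +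
      ((ind d₁ A + ind e₁ A - 1) + (ind d₂ A + ind e₂ A - 1) + (ind d₃ A + ind e₃ A - 1))
  have nonneg : 0 ≤ 3 * ∑ Y ∈ D.powerset, weightSum (fun n =>
      2 * (ind x (Y ∪ corner x y z n) + ind y (Y ∪ corner x y z n) + ind z (Y ∪ corner x y z n)) -
        3 + ((ind d₁ (Y ∪ corner x y z n) + ind e₁ (Y ∪ corner x y z n) - 1) +
        (ind d₂ (Y ∪ corner x y z n) + ind e₂ (Y ∪ corner x y z n) - 1) +
        (ind d₃ (Y ∪ corner x y z n) + ind e₃ (Y ∪ corner x y z n) - 1)))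
      (traceMask F x y z Y) := by
    refine (add_nonneg (add_nonneg s₁ s₂) s₃).trans ?_
    rw [← Finset.sum_add_distrib, ← Finset.sum_add_distrib, Finset.mul_sum]
    refine Finset.sum_le_sum fun Y hY => ?_
    have hYD := Finset.mem_powerset.mp hY
    have mem := traceMask_mem_closedMasks hF hxyz Y
    have c := charge_add_charge_add_charge_le _ mem
    obtain ⟨k₁, k₂⟩ := maskCard_relabelMask _ mem
    rw [traceMask_swap_first_second F x y z, traceMask_swap_first_third F x y z, k₁, k₂]
    have split : weightSum (fun n =>
      2 * (ind x (Y ∪ corner x y z n) + ind y (Y ∪ corner x y z n) + ind z (Y ∪ corner x y z n)) -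
        3 + ((ind d₁ (Y ∪ corner x y z n) + ind e₁ (Y ∪ corner x y z n) - 1) +
        (ind d₂ (Y ∪ corner x y z n) + ind e₂ (Y ∪ corner x y z n) - 1) +
        (ind d₃ (Y ∪ corner x y z n) + ind e₃ (Y ∪ corner x y z n) - 1)))
        (traceMask F x y z Y) =
        weightSum (fun n => 2 * cornerSize n - 3) (traceMask F x y z Y) +
          ((ind d₁ Y + ind e₁ Y - 1) + (ind d₂ Y + ind e₂ Y - 1) + (ind d₃ Y + ind e₃ Y - 1)) *
            maskCard (traceMask F x y z Y) := by
      rw [← weightSum_add_const]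
      refine weightSum_congr (fun n _ => ?_) _
      have out {i : ℕ} (hi : i ∈ W) : ind i (Y ∪ corner x y z n) = ind i Y := by
        have hi' := hWD hi
        simp only [hDdef, Finset.mem_sdiff, Finset.mem_insert, Finset.mem_singleton,
          not_or] at hi'
        simp only [ind, mem_union_corner hi'.2.1 hi'.2.2.1 hi'.2.2.2]
      have hn := sum_ite_mem_corner hxy hxz hyz (fun h => hxD (hYD h)) (fun h => hyD (hYD h))
        (fun h => hzD (hYD h)) n
      rw [out (i := d₁) (by simp [hW]), out (i := e₁) (by simp [hW]),
        out (i := d₂) (by simp [hW]), out (i := e₂) (by simp [hW]),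
        out (i := d₃) (by simp [hW]), out (i := e₃) (by simp [hW])]
      simp only [← hn, ind]
    rw [split]
    simp only [ind]
    linarith
  rw [← total] at nonneg
  have lx := lt (i := x) (by simp)
  have ly := lt (i := y) (by simp)
  have lz := lt (i := z) (by simp)
  have ld₁ := lt (i := d₁) (by simp [hW])
  have le₁ := lt (i := e₁) (by simp [hW])
  have ld₂ := lt (i := d₂) (by simp [hW])
  have le₂ := lt (i := e₂) (by simp [hW])
  have ld₃ := lt (i := d₃) (by simp [hW])
  have le₃ := lt (i := e₃) (by simp [hW])
  simp only [Finset.sum_add_distrib, Finset.sum_sub_distrib, ← Finset.mul_sum, ind] at nonneg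
  simp at *
  linarith

/-- Two triples sharing two points, and a triple meeting each of them in one of the remaining
points, form a Frankl-complete configuration. -/
theorem exists_le_of_three_triples {F : Finset (Finset ℕ)} (hF : UC F) {x y z d e : ℕ}
    (hxy : x ≠ y) (hxz : x ≠ z) (hyz : y ≠ z) (hde : d ≠ e) (hd : d ∉ ({x, y, z} : Finset ℕ))
    (he : e ∉ ({x, y, z} : Finset ℕ)) (hxyz : {x, y, z} ∈ F) (hxyd : {x, y, d} ∈ F)
    (hzde : {z, d, e} ∈ F) :
    ∃ i ∈ insert x (insert y (insert z ({d, e} : Finset ℕ))), F.card ≤ 2 * (memFam F i).card := by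
  by_contra! hlt
  have lt {i : ℕ} (hi : i ∈ insert x (insert y (insert z ({d, e} : Finset ℕ)))) := sum_ite_mem_lt (hlt i hi)
  set D := (famU F ∪ {d, e}) \ {x, y, z} with hDdef
  have hxD : x ∉ D := by simp [hDdef]
  have hyD : y ∉ D := by simp [hDdef]
  have hzD : z ∉ D := by simp [hDdef]
  have hdD : d ∈ D := by rw [hDdef, Finset.mem_sdiff]; exact ⟨by simp, hd⟩
  have heD : e ∈ D := by rw [hDdef, Finset.mem_sdiff]; exact ⟨by simp, he⟩
  simp only [Finset.mem_insert, Finset.mem_singleton, not_or] at hd he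
  let ind (i : ℕ) (A : Finset ℕ) : ℤ := if i ∈ A then 1 else 0
  let score (A : Finset ℕ) : ℤ :=
    4 * (ind x A + ind y A + ind z A) + (4 * ind d A + 2 * ind e A - 9)
  have nonneg : 0 ≤ ∑ A ∈ F, score A := by
    rw [sum_eq_sum_weightSum hxy hxz hyz hxD hyD hzD (subset_insert_sdiff F {d, e}) score]
    have score_corner {Y : Finset ℕ} (hY : Y ⊆ D) :
        weightSum (fun n => score (Y ∪ corner x y z n)) (traceMask F x y z Y) =
          shiftedScore (4 * ind d Y + 2 * ind e Y - 9) (traceMask F x y z Y) := by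
      refine weightSum_congr (fun n _ => ?_) _
      have hn := sum_ite_mem_corner hxy hxz hyz (fun h => hxD (hY h)) (fun h => hyD (hY h))
        (fun h => hzD (hY h)) n
      simp only [score, ind, hn, mem_union_corner hd.1 hd.2.1 hd.2.2,
        mem_union_corner he.1 he.2.1 he.2.2]
    rw [Finset.sum_congr rfl fun Y hY => score_corner (Finset.mem_powerset.mp hY),
      sum_powerset_eq_sum_square hde hdD heD]
    refine Finset.sum_nonneg fun Y hY => ?_
    have hdY : d ∉ Y := fun h => by simpa using Finset.mem_powerset.mp hY h
    have heY : e ∉ Y := fun h => by simpa using Finset.mem_powerset.mp hY h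
    have mem := traceMask_mem_closedMasks hF hxyz
    have corner_three : corner x y z 3 ∪ {d} ∈ F := by
      convert hxyd using 1
      ext a; simp [corner, Nat.testBit]
    have corner_four : corner x y z 4 ∪ {d, e} ∈ F := by
      convert hzde using 1
      ext a; simp [corner, Nat.testBit]; tauto
    have key := le_of_squareCheck shiftedScore_square_nonneg (mem Y) (mem (insert d Y))
      (mem (insert e Y)) (mem (insert d (insert e Y)))
      (maskRel_traceMask hF (by grind) (by simpa using ⟨_, corner_three, by grind⟩) (by simp))
      (maskRel_traceMask hF (by grind) (by simp) (by simp))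
      (maskRel_traceMask hF (by grind) (by simpa using ⟨_, corner_four, by grind⟩) (by simp))
      (maskRel_traceMask hF (by grind) (by simpa using ⟨_, corner_four, by grind⟩) (by simp))
      (maskRel_traceMask hF (by grind)
        (by simpa using ⟨⟨_, corner_three, by grind⟩, ⟨_, corner_four, by grind⟩⟩) (by simp))
      (maskRel_traceMask hF subset_rfl
        (by simpa using ⟨⟨_, corner_three, by grind⟩, ⟨_, corner_four, by grind⟩⟩) (by simp))
    simpa [ind, hde, hde.symm, hdY, heY] using key
  have lx := lt (i := x) (by simp)
  have ly := lt (i := y) (by simp)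
  have lz := lt (i := z) (by simp)
  have ld := lt (i := d) (by simp)
  have le := lt (i := e) (by simp)
  simp only [score, Finset.sum_add_distrib, Finset.sum_sub_distrib, ← Finset.mul_sum, ind]
    at nonneg
  simp only [Finset.sum_const, nsmul_eq_mul, mul_one] at *
  linarith

/-! ### Non-Frankl-complete families of triples -/

theorem NonFC.exists_of_gen {S : Finset (Finset ℕ)} (h : NonFC (gen S)) :
    ∃ F : Finset (Finset ℕ), UC F ∧ S ⊆ F ∧
      ∀ A ∈ S, ∀ i ∈ A, 2 * (memFam F i).card < F.card := by
  obtain ⟨F, hF, hSF, hlt⟩ := h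
  have hS : S ⊆ gen S := fun A hA =>
    Finset.mem_image.mpr ⟨{A}, by simpa using hA, by simp⟩
  exact ⟨F, hF, hS.trans hSF, fun A hA i hi =>
    hlt i (Finset.mem_sup.mpr ⟨A, hS hA, hi⟩)⟩

theorem exists_other_member {S : Finset (Finset ℕ)} {i : ℕ} {T : Finset ℕ} (hT : T ∈ S)
    (hi : i ∈ T) (h : (memFam S i).card = 2) :
    ∃ A ∈ S, A ≠ T ∧ i ∈ A ∧ ∀ B ∈ S, i ∈ B → B = T ∨ B = A := by
  have hTi : T ∈ memFam S i := Finset.mem_filter.mpr ⟨hT, hi⟩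
  obtain ⟨A, hA⟩ := Finset.card_eq_one.mp
    (by rw [Finset.card_erase_of_mem hTi, h] : ((memFam S i).erase T).card = 1)
  have hA' : A ∈ (memFam S i).erase T := by simp [hA]
  obtain ⟨hne, hAS⟩ := Finset.mem_erase.mp hA'
  obtain ⟨hAS, hiA⟩ := Finset.mem_filter.mp hAS
  refine ⟨A, hAS, hne, hiA, fun B hB hiB => or_iff_not_imp_left.mpr fun hBT => ?_⟩
  have : B ∈ (memFam S i).erase T := Finset.mem_erase.mpr ⟨hBT, Finset.mem_filter.mpr ⟨hB, hiB⟩⟩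
  simpa [hA] using this

theorem exists_eq_triple {A : Finset ℕ} {i : ℕ} (hA : A.card = 3) (hi : i ∈ A) :
    ∃ d e, d ≠ e ∧ d ≠ i ∧ e ≠ i ∧ A = {i, d, e} := by
  obtain ⟨d, e, hde, h⟩ := Finset.card_eq_two.mp
    (by rw [Finset.card_erase_of_mem hi, hA] : (A.erase i).card = 2)
  have hd : d ∈ A.erase i := by simp [h]
  have he : e ∈ A.erase i := by simp [h]
  exact ⟨d, e, hde, Finset.ne_of_mem_erase hd, Finset.ne_of_mem_erase he,
    by rw [← h, Finset.insert_erase hi]⟩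

theorem exists_mapFam_subset {S : Finset (Finset ℕ)} {i j k d u v : ℕ}
    (hnodup : [i, j, k, d, u, v].Nodup) (hT : {i, j, k} ∈ S) (hA : {i, j, d} ∈ S)
    (hB : {k, u, v} ∈ S) :
    ∃ f : ℕ → ℕ, Function.Injective f ∧
      mapFam f ({{1,2,3},{1,2,4},{3,5,6}} : Finset (Finset ℕ)) ⊆ S := by
  simp only [List.nodup_cons, List.mem_cons, List.not_mem_nil, or_false, not_or,
    List.nodup_nil, and_true, not_false_eq_true] at hnodup
  refine ⟨fun n => if n = 1 then i else if n = 2 then j else if n = 3 then k else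
    if n = 4 then d else if n = 5 then u else if n = 6 then v else
      n + (i + j + k + d + u + v + 1), fun m n hmn => ?_, ?_⟩
  · dsimp only at hmn
    split_ifs at hmn <;> omega
  · intro X hX
    simp only [mapFam, Finset.image_insert, Finset.image_singleton, Finset.mem_insert,
      Finset.mem_singleton] at hX
    rcases hX with rfl | rfl | rfl
    · exact hT
    · exact hA
    · exact hB

/-- If some other member of `S` shares two points with the triple `{i, j, k}`, the member through
the third point completes the required configuration. -/
theorem exists_mapFam_subset_of_shared_pair {S F : Finset (Finset ℕ)} (h3 : ∀ A ∈ S, A.card = 3)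
    (hF : UC F) (hSF : S ⊆ F) (hlt : ∀ A ∈ S, ∀ i ∈ A, 2 * (memFam F i).card < F.card)
    {i j k : ℕ} (hij : i ≠ j) (hik : i ≠ k) (hjk : j ≠ k) (hT : {i, j, k} ∈ S)
    (hi : (memFam S i).card = 2) (hj : (memFam S j).card = 2) (hk : (memFam S k).card = 2)
    {A : Finset ℕ} (hA : A ∈ S) (hAT : A ≠ {i, j, k}) (hiA : i ∈ A) (hjA : j ∈ A) :
    ∃ f : ℕ → ℕ, Function.Injective f ∧
      mapFam f ({{1,2,3},{1,2,4},{3,5,6}} : Finset (Finset ℕ)) ⊆ S := by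
  have hAd : ∃ d, d ≠ i ∧ d ≠ j ∧ A = {i, j, d} := by
    obtain ⟨a, b, hab, hai, hbi, rfl⟩ := exists_eq_triple (h3 A hA) hiA
    simp only [Finset.mem_insert, Finset.mem_singleton] at hjA
    rcases hjA with h | rfl | rfl
    · exact absurd h hij.symm
    · exact ⟨b, hbi, hab.symm, rfl⟩
    · exact ⟨a, hai, hab, by rw [Finset.pair_comm]⟩
  obtain ⟨d, hdi, hdj, rfl⟩ := hAd
  have hdk : d ≠ k := by rintro rfl; exact hAT rfl
  obtain ⟨B, hB, hBT, hkB, -⟩ := exists_other_member hT (by simp) hk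
  have hBA : B ≠ {i, j, d} := by
    rintro rfl
    simp [hik.symm, hjk.symm, hdk.symm] at hkB
  have not_mem {l : ℕ} (hlT : l ∈ ({i, j, k} : Finset ℕ)) (hlA : l ∈ ({i, j, d} : Finset ℕ))
      (hl : (memFam S l).card = 2) : l ∉ B := by
    intro hlB
    obtain ⟨C, -, -, -, hC⟩ := exists_other_member hT hlT hl
    have h₁ := (hC _ hA hlA).resolve_left hAT
    have h₂ := (hC _ hB hlB).resolve_left hBT
    exact hBA (h₂.trans h₁.symm)
  have hiB := not_mem (by simp) (by simp) hi
  have hjB := not_mem (by simp) (by simp) hj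
  by_cases hdB : d ∈ B
  · exfalso
    have hBe : ∃ e, e ≠ d ∧ e ≠ k ∧ B = {k, d, e} := by
      obtain ⟨a, b, hab, hak, hbk, rfl⟩ := exists_eq_triple (h3 B hB) hkB
      simp only [Finset.mem_insert, Finset.mem_singleton] at hdB
      rcases hdB with h | rfl | rfl
      · exact absurd h hdk
      · exact ⟨b, hab.symm, hbk, rfl⟩
      · exact ⟨a, hab, hak, by rw [Finset.pair_comm a]⟩
    obtain ⟨e, hed, hek, rfl⟩ := hBe
    simp only [Finset.mem_insert, Finset.mem_singleton, not_or] at hiB hjB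
    obtain ⟨l, hl, hle⟩ := exists_le_of_three_triples hF hij hik hjk hed.symm
      (by simp [hdi, hdj, hdk]) (by simp [Ne.symm hiB.2.2, Ne.symm hjB.2.2, hek])
      (hSF hT) (hSF hA) (hSF hB)
    refine absurd hle (not_le.mpr ?_)
    simp only [Finset.mem_insert, Finset.mem_singleton] at hl
    rcases hl with rfl | rfl | rfl | rfl | rfl
    · exact hlt _ hT _ (by simp)
    · exact hlt _ hT _ (by simp)
    · exact hlt _ hT _ (by simp)
    · exact hlt _ hA _ (by simp)
    · exact hlt _ hB _ (by simp)
  · obtain ⟨u, v, huv, huk, hvk, rfl⟩ := exists_eq_triple (h3 B hB) hkB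
    refine exists_mapFam_subset ?_ hT hA hB
    simp only [Finset.mem_insert, Finset.mem_singleton, not_or] at hiB hjB hdB
    simp [hij, hik, hjk, hdi.symm, hdj.symm, hdk.symm, huv, huk.symm, hvk.symm, hiB, hjB, hdB]

theorem nonfc_contains_iso_I (S : Finset (Finset ℕ))
    (h3 : ∀ A ∈ S, A.card = 3) (hpos : ∀ A ∈ S, ∀ x ∈ A, 0 < x)
    (hnfc : NonFC (gen S)) (h123 : ({1,2,3} : Finset ℕ) ∈ S)
    (h1 : (memFam S 1).card = 2) (h2 : (memFam S 2).card = 2)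
    (h3' : (memFam S 3).card = 2) :
    ∃ f : ℕ → ℕ, Function.Injective f ∧
      mapFam f ({{1,2,3},{1,2,4},{3,5,6}} : Finset (Finset ℕ)) ⊆ S := by
  obtain ⟨F, hF, hSF, hlt⟩ := hnfc.exists_of_gen
  obtain ⟨A₁, hA₁, hne₁, hm₁, -⟩ := exists_other_member h123 (by simp) h1
  obtain ⟨A₂, hA₂, hne₂, hm₂, -⟩ := exists_other_member h123 (by simp) h2
  obtain ⟨A₃, hA₃, hne₃, hm₃, -⟩ := exists_other_member h123 (by simp) h3'
  have h132 : ({1, 3, 2} : Finset ℕ) = {1, 2, 3} := by decide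
  have h231 : ({2, 3, 1} : Finset ℕ) = {1, 2, 3} := by decide
  have shared {A : Finset ℕ} (hA : A ∈ S) (hne : A ≠ {1, 2, 3})
      (h : (1 ∈ A ∧ 2 ∈ A) ∨ (1 ∈ A ∧ 3 ∈ A) ∨ (2 ∈ A ∧ 3 ∈ A)) :
      ∃ f : ℕ → ℕ, Function.Injective f ∧
        mapFam f ({{1,2,3},{1,2,4},{3,5,6}} : Finset (Finset ℕ)) ⊆ S := by
    rcases h with ⟨ha, hb⟩ | ⟨ha, hb⟩ | ⟨ha, hb⟩
    · exact exists_mapFam_subset_of_shared_pair h3 hF hSF hlt (by decide) (by decide)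
        (by decide) h123 h1 h2 h3' hA hne ha hb
    · exact exists_mapFam_subset_of_shared_pair h3 hF hSF hlt (by decide) (by decide)
        (by decide) (h132 ▸ h123) h1 h3' h2 hA (h132 ▸ hne) ha hb
    · exact exists_mapFam_subset_of_shared_pair h3 hF hSF hlt (by decide) (by decide)
        (by decide) (h231 ▸ h123) h2 h3' h1 hA (h231 ▸ hne) ha hb
  by_contra hcon
  have not_mem {A : Finset ℕ} (hA : A ∈ S) (hne : A ≠ {1, 2, 3}) :
      (1 ∈ A → 2 ∉ A ∧ 3 ∉ A) ∧ (2 ∈ A → 1 ∉ A ∧ 3 ∉ A) ∧ (3 ∈ A → 1 ∉ A ∧ 2 ∉ A) := by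
    have := fun h => hcon (shared hA hne h)
    tauto
  have n₁ := (not_mem hA₁ hne₁).1 hm₁
  have n₂ := (not_mem hA₂ hne₂).2.1 hm₂
  have n₃ := (not_mem hA₃ hne₃).2.2 hm₃
  obtain ⟨d₁, e₁, hde₁, hd₁, he₁, rfl⟩ := exists_eq_triple (h3 A₁ hA₁) hm₁
  obtain ⟨d₂, e₂, hde₂, hd₂, he₂, rfl⟩ := exists_eq_triple (h3 A₂ hA₂) hm₂
  obtain ⟨d₃, e₃, hde₃, hd₃, he₃, rfl⟩ := exists_eq_triple (h3 A₃ hA₃) hm₃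
  simp only [Finset.mem_insert, Finset.mem_singleton, not_or] at n₁ n₂ n₃
  obtain ⟨i, hi, hle⟩ := exists_le_of_triple_of_pendants hF (x := 1) (y := 2) (z := 3)
    (by decide) (by decide) (by decide) hde₁ hde₂ hde₃ rfl (by simp [n₂, n₃, hd₁.symm, he₁.symm]) (by simp [n₁, n₃, hd₂.symm, he₂.symm])
    (by simp [n₁, n₂, hd₃.symm, he₃.symm]) (hSF h123) (hSF hA₁) (hSF hA₂) (hSF hA₃)
  refine absurd hle (not_le.mpr ?_)
  simp only [Finset.mem_insert, Finset.mem_singleton] at hi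
  rcases hi with rfl | rfl | rfl | rfl | rfl | rfl | rfl | rfl | rfl
  · exact hlt _ hA₁ _ (by simp)
  · exact hlt _ hA₂ _ (by simp)
  · exact hlt _ hA₃ _ (by simp)
  · exact hlt _ hA₁ _ (by simp)
  · exact hlt _ hA₁ _ (by simp)
  · exact hlt _ hA₂ _ (by simp)
  · exact hlt _ hA₂ _ (by simp)
  · exact hlt _ hA₃ _ (by simp)
  · exact hlt _ hA₃ _ (by simp)
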